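/- For every X ∈ K and every U ∈ T_X K one has P_{H_X}(U) − U ∈ N_X K. -/

import Mathlib

open MeasureTheory Set Filter
open scoped ENNReal NNReal RealInnerProductSpace

noncomputable section

/-- The interval `Ω = (0,1)`. -/
def Omg : Set ℝ := Set.Ioo 0 1

/-- Lebesgue measure restricted to `(0,1)`. -/
def mu : Measure ℝ := volume.restrict Omg

/-- The Hilbert space `L²(Ω)`. -/
abbrev L2 : Type := Lp ℝ 2 mu

/-- The cone `K` of functions in `L²(Ω)` admitting a nondecreasing representative. -/
def Kcone : Set L2 := {X | ∃ g : ℝ → ℝ, MonotoneOn g Omg ∧ ⇑X =ᵐ[mu] g}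

/-- The normal cone to `K` at `X`. -/
def normalCone (X : L2) : Set L2 := {W | ∀ Y ∈ Kcone, ⟪W, Y - X⟫ ≤ 0}

/-- The tangent cone to `K` at `X`: the `L²`-closure of `{θ(Y − X) : Y ∈ K, θ ≥ 0}`. -/
def tangentCone (X : L2) : Set L2 :=
  closure {U | ∃ Y ∈ Kcone, ∃ θ : ℝ, 0 ≤ θ ∧ U = θ • (Y - X)}

/-- `Ω_X`: points of `Ω` near which `X` is (essentially) constant. -/
def OmegaX (X : L2) : Set ℝ :=
  {m | m ∈ Omg ∧ ∃ U ∈ nhds m, ∃ c : ℝ, ∀ᵐ x ∂(mu.restrict U), X x = c}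

/-- The closed subspace `H_X` of functions admitting a representative that is constant on
each connected component of `Ω_X`. -/
def HX (X : L2) : Set L2 :=
  {U | ∃ g : ℝ → ℝ, ⇑U =ᵐ[mu] g ∧
    ∀ m ∈ OmegaX X, ∀ m' ∈ connectedComponentIn (OmegaX X) m, g m' = g m}

/-- `P` is the orthogonal projection of `V` onto `H_X`. -/
def IsProjHX (X V P : L2) : Prop := P ∈ HX X ∧ ∀ U ∈ HX X, ⟪V - P, U⟫ = 0

/-- Chebyshev's integral inequality for two functions that vary together. -/
theorem integral_mul_integral_le_of_comonotone {α : Type*} [MeasurableSpace α] {ν : Measure α}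
    [IsFiniteMeasure ν] {f h : α → ℝ} (hf : Integrable f ν) (hh : Integrable h ν)
    (hfh : Integrable (fun x => f x * h x) ν)
    (hmono : ∀ᵐ x ∂ν, ∀ᵐ y ∂ν, 0 ≤ (f x - f y) * (h x - h y)) :
    (∫ x, f x ∂ν) * (∫ x, h x ∂ν) ≤ ν.real univ * ∫ x, f x * h x ∂ν := by
  have expand : ∀ x, ∫ y, (f x - f y) * (h x - h y) ∂ν =
      ν.real univ * (f x * h x) - f x * (∫ y, h y ∂ν) - h x * (∫ y, f y ∂ν)
        + ∫ y, f y * h y ∂ν := by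
    intro x
    have e : (fun y => (f x - f y) * (h x - h y)) =
        fun y => ((f x * h x - f x * h y) - h x * f y) + f y * h y := by
      funext y; ring
    have i₁ : Integrable (fun y => f x * h x - f x * h y) ν :=
      (integrable_const _).sub (hh.const_mul _)
    have i₂ : Integrable (fun y => f x * h x - f x * h y - h x * f y) ν := i₁.sub (hf.const_mul _)
    rw [e, integral_add i₂ hfh, integral_sub i₁ (hf.const_mul _),
      integral_sub (integrable_const _) (hh.const_mul _), integral_const, integral_const_mul,
      integral_const_mul, smul_eq_mul]
  have nonneg : 0 ≤ ∫ x, (∫ y, (f x - f y) * (h x - h y) ∂ν) ∂ν :=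
    integral_nonneg_of_ae (hmono.mono fun x hx => integral_nonneg_of_ae hx)
  simp_rw [expand] at nonneg
  have i₁ := hfh.const_mul (ν.real univ)
  have i₂ := hf.mul_const (∫ y, h y ∂ν)
  have i₃ := hh.mul_const (∫ y, f y ∂ν)
  have i₁₂ : Integrable (fun x => ν.real univ * (f x * h x) - f x * (∫ y, h y ∂ν)) ν := i₁.sub i₂
  have i₁₂₃ : Integrable (fun x => ν.real univ * (f x * h x) - f x * (∫ y, h y ∂ν)
      - h x * (∫ y, f y ∂ν)) ν := i₁₂.sub i₃
  rw [integral_add i₁₂₃ (integrable_const _), integral_sub i₁₂ i₃,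
    integral_sub i₁ i₂, integral_const, integral_const_mul, integral_mul_const,
    integral_mul_const, smul_eq_mul] at nonneg
  linarith

instance isFiniteMeasure_mu : IsFiniteMeasure mu := by
  unfold mu Omg
  infer_instance

theorem integrable_coe_L2 (F : L2) : Integrable F mu :=
  (Lp.memLp F).integrable (by norm_num)

theorem integrable_mul_L2 (F G : L2) : Integrable (fun x => F x * G x) mu :=
  (Lp.memLp F).integrable_mul (Lp.memLp G)

theorem inner_eq_integral_mul (F G : L2) : ⟪F, G⟫ = ∫ x, F x * G x ∂mu := by
  rw [L2.inner_def]
  exact integral_congr_ae (Eventually.of_forall fun x => by simp [mul_comm])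

/-- The restriction of an `L²` function to a measurable set, extended by zero. -/
def indicatorL2 {s : Set ℝ} (hs : MeasurableSet s) (F : L2) : L2 :=
  ((Lp.memLp F).indicator hs).toLp _

theorem coeFn_indicatorL2 {s : Set ℝ} (hs : MeasurableSet s) (F : L2) :
    ⇑(indicatorL2 hs F) =ᵐ[mu] s.indicator F :=
  MemLp.coeFn_toLp _

theorem inner_indicatorL2 {s : Set ℝ} (hs : MeasurableSet s) (F G : L2) :
    ⟪F, indicatorL2 hs G⟫ = ∫ x in s, F x * G x ∂mu := by
  rw [inner_eq_integral_mul, ← integral_indicator hs]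
  refine integral_congr_ae ?_
  filter_upwards [coeFn_indicatorL2 hs G] with x hx
  by_cases h : x ∈ s <;> simp [hx, h]

theorem inner_indicatorConstLp {s : Set ℝ} (hs : MeasurableSet s) (F : L2) :
    ⟪F, indicatorConstLp 2 hs (measure_ne_top mu s) (1 : ℝ)⟫ = ∫ x in s, F x ∂mu := by
  rw [real_inner_comm, L2.inner_indicatorConstLp_one]

theorem OmegaX_subset_Omg (X : L2) : OmegaX X ⊆ Omg := fun _ hm => hm.1

theorem isOpen_OmegaX (X : L2) : IsOpen (OmegaX X) := by
  rw [isOpen_iff_mem_nhds]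
  rintro m ⟨hm, V, hV, c, hc⟩
  filter_upwards [isOpen_Ioo.mem_nhds hm, eventually_mem_nhds_iff.2 hV] with y hy hyV
  exact ⟨hy, V, hyV, c, hc⟩

/-- A nonempty open subset of `Ω` has positive measure. -/
theorem mu_pos_of_isOpen {s : Set ℝ} (hs : IsOpen s) (hsub : s ⊆ Omg) (hne : s.Nonempty) :
    0 < mu s := by
  rw [mu, Measure.restrict_eq_self _ hsub]
  exact hs.measure_pos volume hne

/-- A monotone representative of `X` is genuinely locally constant on `Ω_X`. -/
theorem eventually_eq_of_mem_OmegaX {X : L2} {g : ℝ → ℝ} (hg : MonotoneOn g Omg)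
    (hXg : ⇑X =ᵐ[mu] g) {m : ℝ} (hm : m ∈ OmegaX X) : ∃ c, ∀ᶠ x in nhds m, g x = c := by
  obtain ⟨hmO, V, hV, c, hc⟩ := hm
  obtain ⟨a, b, ⟨ham, hmb⟩, hab⟩ :=
    mem_nhds_iff_exists_Ioo_subset.1 (inter_mem hV (isOpen_Ioo.mem_nhds hmO))
  have hgc : ∀ᵐ x ∂(mu.restrict (Ioo a b)), g x = c := by
    filter_upwards [ae_restrict_of_ae_restrict_of_subset (fun x hx => (hab hx).1) hc,
      ae_restrict_of_ae hXg] with x h₁ h₂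
    rw [← h₂, h₁]
  have hex : ∀ p q, a ≤ p → p < q → q ≤ b → ∃ z ∈ Ioo p q, g z = c := by
    intro p q hap hpq hqb
    by_contra! hcon
    have hsub : Ioo p q ⊆ Ioo a b := Ioo_subset_Ioo hap hqb
    have h₀ : mu (Ioo p q) = 0 := by
      have := ae_restrict_of_ae_restrict_of_subset hsub hgc
      rw [ae_restrict_iff' measurableSet_Ioo] at this
      refine measure_mono_null (fun z hz => ?_) this
      exact fun h => hcon z hz (h hz)
    exact (mu_pos_of_isOpen isOpen_Ioo (fun z hz => (hab (hsub hz)).2)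
      (nonempty_Ioo.2 hpq)).ne' h₀
  refine ⟨c, ?_⟩
  filter_upwards [Ioo_mem_nhds ham hmb] with x hx
  obtain ⟨y, hy, hyc⟩ := hex a x le_rfl hx.1 hx.2.le
  obtain ⟨z, hz, hzc⟩ := hex x b hx.1.le hx.2 le_rfl
  have hxO := (hab hx).2
  have h₁ := hg (hab ⟨hy.1, hy.2.trans hx.2⟩).2 hxO hy.2.le
  have h₂ := hg hxO (hab ⟨hx.1.trans hz.1, hz.2⟩).2 hz.1.le
  linarith

/-- A monotone representative of `X` is constant on the components of `Ω_X`. -/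
theorem eq_of_mem_connectedComponentIn {X : L2} {g : ℝ → ℝ} (hg : MonotoneOn g Omg)
    (hXg : ⇑X =ᵐ[mu] g) {m m' : ℝ} (hm : m ∈ OmegaX X)
    (hm' : m' ∈ connectedComponentIn (OmegaX X) m) : g m' = g m := by
  have hd : ∀ x ∈ connectedComponentIn (OmegaX X) m, HasDerivAt g 0 x := by
    intro x hx
    obtain ⟨c, hc⟩ := eventually_eq_of_mem_OmegaX hg hXg (connectedComponentIn_subset _ _ hx)
    exact (hasDerivAt_const x c).congr_of_eventuallyEq hc
  exact (isOpen_OmegaX X).connectedComponentIn.is_const_of_deriv_eq_zero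
    isPreconnected_connectedComponentIn
    (fun x hx => (hd x hx).differentiableAt.differentiableWithinAt)
    (fun x hx => (hd x hx).deriv) hm' (mem_connectedComponentIn hm)

theorem self_mem_HX {X : L2} (hX : X ∈ Kcone) : X ∈ HX X := by
  obtain ⟨g, hg, hXg⟩ := hX
  exact ⟨g, hXg, fun m hm m' hm' => eq_of_mem_connectedComponentIn hg hXg hm hm'⟩

theorem indicatorConstLp_mem_HX (X : L2) {m : ℝ}
    (hC : MeasurableSet (connectedComponentIn (OmegaX X) m)) :
    indicatorConstLp 2 hC (measure_ne_top mu _) (1 : ℝ) ∈ HX X := by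
  refine ⟨_, indicatorConstLp_coeFn, fun p hp q hq => ?_⟩
  have hiff : q ∈ connectedComponentIn (OmegaX X) m ↔ p ∈ connectedComponentIn (OmegaX X) m := by
    have hpq := connectedComponentIn_eq hq
    constructor
    · intro h
      rw [connectedComponentIn_eq h, ← hpq]
      exact mem_connectedComponentIn hp
    · intro h
      rwa [connectedComponentIn_eq h]
  by_cases h : p ∈ connectedComponentIn (OmegaX X) m
  · rw [indicator_of_mem h, indicator_of_mem (hiff.2 h)]
  · rw [indicator_of_notMem h, indicator_of_notMem (mt hiff.1 h)]

theorem indicatorL2_compl_mem_HX (X F : L2) (hs : MeasurableSet (OmegaX X)ᶜ) :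
    indicatorL2 hs F ∈ HX X := by
  refine ⟨_, coeFn_indicatorL2 hs F, fun m hm m' hm' => ?_⟩
  have hm'' := connectedComponentIn_subset _ _ hm'
  rw [indicator_of_notMem (notMem_compl_iff.2 hm''),
    indicator_of_notMem (notMem_compl_iff.2 hm)]

/-- A function of `H_X` is almost everywhere constant on each component of `Ω_X`. -/
theorem exists_ae_eq_const_of_mem_HX {X F : L2} (hF : F ∈ HX X) {m : ℝ} (hm : m ∈ OmegaX X) :
    ∃ c, ∀ᵐ x ∂(mu.restrict (connectedComponentIn (OmegaX X) m)), F x = c := by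
  obtain ⟨g, hFg, hg⟩ := hF
  refine ⟨g m, ?_⟩
  filter_upwards [ae_restrict_of_ae hFg,
    ae_restrict_mem (isOpen_OmegaX X).connectedComponentIn.measurableSet] with x hx hxC
  rw [hx, hg m hm x hxC]

/-- Two elements of `K` are nonnegatively correlated on every measurable subset of `Ω`. -/
theorem setIntegral_mul_setIntegral_le {Y Z : L2} (hY : Y ∈ Kcone) (hZ : Z ∈ Kcone) {s : Set ℝ}
    (hs : MeasurableSet s) (hsub : s ⊆ Omg) :
    (∫ x in s, Z x ∂mu) * (∫ x in s, Y x ∂mu) ≤ mu.real s * ∫ x in s, Z x * Y x ∂mu := by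
  obtain ⟨g, hg, hYg⟩ := hY
  obtain ⟨k, hk, hZk⟩ := hZ
  have hae : ∀ᵐ x ∂(mu.restrict s), x ∈ Omg ∧ Y x = g x ∧ Z x = k x := by
    filter_upwards [ae_restrict_of_ae hYg, ae_restrict_of_ae hZk, ae_restrict_mem hs]
      with x h₁ h₂ h₃ using ⟨hsub h₃, h₁, h₂⟩
  have := integral_mul_integral_le_of_comonotone (ν := mu.restrict s)
    (integrable_coe_L2 Z).restrict (integrable_coe_L2 Y).restrict
    (integrable_mul_L2 Z Y).restrict ?_
  · simpa [measureReal_restrict_apply_univ] using this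
  filter_upwards [hae] with x ⟨hxO, hx₁, hx₂⟩
  filter_upwards [hae] with y ⟨hyO, hy₁, hy₂⟩
  rw [hx₁, hx₂, hy₁, hy₂]
  rcases le_total x y with h | h
  · exact mul_nonneg_of_nonpos_of_nonpos (sub_nonpos.2 (hk hxO hyO h))
      (sub_nonpos.2 (hg hxO hyO h))
  · exact mul_nonneg (sub_nonneg.2 (hk hyO hxO h)) (sub_nonneg.2 (hg hyO hxO h))

/-- On a subset of `Ω` where `X` is constant, a tangent vector at `X` is nonnegatively correlated
with every element of `K`. -/
theorem setIntegral_mul_setIntegral_le_of_mem_tangentCone {X U Y : L2} (hU : U ∈ tangentCone X)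
    (hY : Y ∈ Kcone) {s : Set ℝ} (hs : MeasurableSet s) (hsub : s ⊆ Omg) {c : ℝ}
    (hc : ∀ᵐ x ∂(mu.restrict s), X x = c) :
    (∫ x in s, U x ∂mu) * (∫ x in s, Y x ∂mu) ≤ mu.real s * ∫ x in s, U x * Y x ∂mu := by
  let T : Set L2 := {F | ⟪F, indicatorConstLp 2 hs (measure_ne_top mu s) (1 : ℝ)⟫ *
    (∫ x in s, Y x ∂mu) ≤ mu.real s * ⟪F, indicatorL2 hs Y⟫}
  have hT : IsClosed T := isClosed_le (by fun_prop) (by fun_prop)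
  have hmem : U ∈ T := by
    refine closure_minimal ?_ hT hU
    rintro _ ⟨Z, hZ, θ, hθ, rfl⟩
    have hZY := setIntegral_mul_setIntegral_le hY hZ hs hsub
    have hX₁ : ∫ x in s, X x ∂mu = mu.real s * c := by
      rw [integral_congr_ae hc, setIntegral_const, smul_eq_mul]
    have hX₂ : ∫ x in s, X x * Y x ∂mu = c * ∫ x in s, Y x ∂mu := by
      rw [← integral_const_mul]
      exact integral_congr_ae (hc.mono fun x hx => by simp only [hx])
    rw [mem_ofPred_eq, real_inner_smul_left, real_inner_smul_left, inner_sub_left, inner_sub_left]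
    simp only [inner_indicatorConstLp, inner_indicatorL2, hX₁, hX₂]
    nlinarith [mul_le_mul_of_nonneg_left hZY hθ]
  simpa only [T, mem_ofPred_eq, inner_indicatorConstLp, inner_indicatorL2] using hmem

/-- The components of `Ω_X`. -/
def componentsOmegaX (X : L2) : Set (Set ℝ) :=
  (fun m => connectedComponentIn (OmegaX X) m) '' OmegaX X

theorem pairwiseDisjoint_componentsOmegaX (X : L2) :
    (componentsOmegaX X).PairwiseDisjoint id := by
  rintro _ ⟨p, hp, rfl⟩ _ ⟨q, hq, rfl⟩ hne
  refine Set.disjoint_left.2 fun z hzp hzq => hne ?_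
  exact (connectedComponentIn_eq hzp).trans (connectedComponentIn_eq hzq).symm

theorem countable_componentsOmegaX (X : L2) : (componentsOmegaX X).Countable := by
  refine (pairwiseDisjoint_componentsOmegaX X).countable_of_isOpen ?_ ?_
  · rintro _ ⟨m, -, rfl⟩
    exact (isOpen_OmegaX X).connectedComponentIn
  · rintro _ ⟨m, hm, rfl⟩
    exact ⟨m, mem_connectedComponentIn hm⟩

theorem sUnion_componentsOmegaX (X : L2) : ⋃₀ componentsOmegaX X = OmegaX X := by
  refine Subset.antisymm (sUnion_subset ?_) fun m hm =>
    ⟨_, ⟨m, hm, rfl⟩, mem_connectedComponentIn hm⟩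
  rintro _ ⟨m, -, rfl⟩
  exact connectedComponentIn_subset _ _

/-- For every `X ∈ K` and every `U ∈ T_X K`,
one has `P_{H_X}(U) − U ∈ N_X K`. -/
theorem stmt6 (X : L2) (hX : X ∈ Kcone) (U : L2) (hU : U ∈ tangentCone X)
    (P : L2) (hP : IsProjHX X U P) :
    P - U ∈ normalCone X := by
  obtain ⟨hPH, hPo⟩ := hP
  intro Y hY
  have hΩ := (isOpen_OmegaX X).measurableSet
  have hXo : ⟪U - P, X⟫ = 0 := hPo X (self_mem_HX hX)
  suffices h : 0 ≤ ⟪U - P, Y⟫ by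
    rw [← neg_sub U P, inner_neg_left, inner_sub_right, hXo]
    linarith
  have hoff : ∀ᵐ x ∂(mu.restrict (OmegaX X)ᶜ), (U - P : L2) x = 0 := by
    have h := hPo _ (indicatorL2_compl_mem_HX X (U - P) hΩ.compl)
    rw [inner_indicatorL2, integral_eq_zero_iff_of_nonneg (fun x => mul_self_nonneg _)
      (integrable_mul_L2 _ _).restrict] at h
    exact h.mono fun x hx => mul_self_eq_zero.1 hx
  have hcomp : ∀ C ∈ componentsOmegaX X, 0 ≤ ∫ x in C, (U - P : L2) x * Y x ∂mu := by
    rintro _ ⟨m, hm, rfl⟩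
    have hopen := (isOpen_OmegaX X).connectedComponentIn (x := m)
    have hsub := (connectedComponentIn_subset (OmegaX X) m).trans (OmegaX_subset_Omg X)
    have hpos : 0 < mu.real (connectedComponentIn (OmegaX X) m) :=
      ENNReal.toReal_pos (mu_pos_of_isOpen hopen hsub ⟨m, mem_connectedComponentIn hm⟩).ne'
        (measure_ne_top _ _)
    obtain ⟨c, hc⟩ := exists_ae_eq_const_of_mem_HX (self_mem_HX hX) hm
    obtain ⟨p, hp⟩ := exists_ae_eq_const_of_mem_HX hPH hm
    have hcheb := setIntegral_mul_setIntegral_le_of_mem_tangentCone hU hY hopen.measurableSet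
      hsub hc
    have hmean := hPo _ (indicatorConstLp_mem_HX X hopen.measurableSet)
    have hP₁ : ∫ x in connectedComponentIn (OmegaX X) m, P x ∂mu =
        mu.real (connectedComponentIn (OmegaX X) m) * p := by
      rw [integral_congr_ae hp, setIntegral_const, smul_eq_mul]
    have hP₂ : ∫ x in connectedComponentIn (OmegaX X) m, P x * Y x ∂mu =
        p * ∫ x in connectedComponentIn (OmegaX X) m, Y x ∂mu := by
      rw [← integral_const_mul]
      exact integral_congr_ae (hp.mono fun x hx => by simp only [hx])
    rw [inner_sub_left, inner_indicatorConstLp, inner_indicatorConstLp, hP₁, sub_eq_zero] at hmean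
    rw [← inner_indicatorL2 hopen.measurableSet, inner_sub_left, inner_indicatorL2,
      inner_indicatorL2, hP₂]
    rw [hmean] at hcheb
    refine nonneg_of_mul_nonneg_right ?_ hpos
    linarith
  have hoff₀ : ∫ x in (OmegaX X)ᶜ, (U - P : L2) x * Y x ∂mu = 0 :=
    integral_eq_zero_of_ae (hoff.mono fun x hx => mul_eq_zero_of_left hx _)
  rw [inner_eq_integral_mul, ← integral_add_compl hΩ (integrable_mul_L2 _ _), hoff₀, add_zero]
  have := (countable_componentsOmegaX X).to_subtype
  rw [← sUnion_componentsOmegaX X, sUnion_eq_iUnion, integral_iUnion]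
  · exact tsum_nonneg fun C => hcomp C C.2
  · rintro ⟨_, m, -, rfl⟩
    exact (isOpen_OmegaX X).connectedComponentIn.measurableSet
  · exact fun C D hne => pairwiseDisjoint_componentsOmegaX X C.2 D.2 (Subtype.coe_ne_coe.2 hne)
  · exact (integrable_mul_L2 _ _).integrableOn
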